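/- arXiv:1212.0889 — 3 statements merged into one kernel-verified Lean document; each statement's English description precedes it below -/
import Mathlib

section
/- The singularity set of H_S is metrically thin (condition KS1): let σ = S ∩ ⋃_{n ≥ 1} frontier (S_n) be the union of the boundaries of the return-time partition elements. Then for every a ∈ (0,1) there exists C > 0 such that for every ε > 0, μ (S ∩ Metric.thickening ε σ) ≤ C * ε ^ a (measuring thickenings in the product metric on 𝕋). -/
open MeasureTheory
open scoped NNReal ENNReal

noncomputable section

instance : Fact ((0:ℝ) < 2) := ⟨by norm_num⟩

/-- The torus, as a product of two circles of circumference 2. -/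
abbrev 𝕋 : Type := AddCircle (2:ℝ) × AddCircle (2:ℝ)

/-- The unique representative in `[0, 2)` of a point of the circle. -/
def θ (x : AddCircle (2:ℝ)) : ℝ := ((AddCircle.equivIco 2 0) x : ℝ)

def P : Set 𝕋 := {z | θ z.2 ≤ 1}
def Q : Set 𝕋 := {z | θ z.1 ≤ 1}
def R : Set 𝕋 := P ∪ Q
def S : Set 𝕋 := P ∩ Q

/-- The horizontal twist map. -/
def F (z : 𝕋) : 𝕋 :=
  if θ z.2 ≤ 1 then (z.1 + (((2 * θ z.2 : ℝ) : AddCircle (2:ℝ))), z.2) else z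

/-- The vertical twist map. -/
def G (z : 𝕋) : 𝕋 :=
  if θ z.1 ≤ 1 then (z.1, z.2 + (((2 * θ z.1 : ℝ) : AddCircle (2:ℝ)))) else z

/-- The linked-twist map. -/
def H : 𝕋 → 𝕋 := G ∘ F

/-- The first-return time of `T` to `S`. -/
def rtn (T : 𝕋 → 𝕋) (z : 𝕋) : ℕ := sInf {n : ℕ | 1 ≤ n ∧ T^[n] z ∈ S}

/-- The first-return map of `T` to `S`. -/
def retMap (T : 𝕋 → 𝕋) (z : 𝕋) : 𝕋 := T^[rtn T z] z

/-- The set of points of `S` with return time exactly `n`. -/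
def Sn (n : ℕ) : Set 𝕋 := {z | z ∈ S ∧ rtn H z = n}

/-- The singularity set of the return map `H_S`: the union of the boundaries of the
return-time partition elements, within `S`. -/
def singSet : Set 𝕋 := S ∩ ⋃ n ∈ {n : ℕ | 1 ≤ n}, frontier (Sn n)

theorem theta_mem_Ico (x : AddCircle (2:ℝ)) : θ x ∈ Set.Ico (0:ℝ) 2 := by
  have h := (AddCircle.equivIco (2:ℝ) 0 x).2
  exact ⟨h.1, h.2.trans_eq (zero_add 2)⟩

theorem coe_theta (x : AddCircle (2:ℝ)) : ((θ x : ℝ) : AddCircle (2:ℝ)) = x :=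
  AddCircle.coe_equivIco

theorem theta_coe_of_mem {r : ℝ} (hr : r ∈ Set.Ico (0:ℝ) 2) :
    θ (r : AddCircle (2:ℝ)) = r :=
  AddCircle.equivIco_coe_of_mem (by rwa [zero_add])

theorem exists_theta_coe (r : ℝ) : ∃ m : ℤ, θ (r : AddCircle (2:ℝ)) = r - 2 * m := by
  refine ⟨⌊r / 2⌋, ?_⟩
  have h : θ (r : AddCircle (2:ℝ)) = Int.fract (r / 2) * 2 :=
    AddCircle.coe_equivIco_mk_apply (p := (2:ℝ)) r
  rw [h, Int.fract]
  ring

theorem coe_sub_two_mul (r : ℝ) (m : ℤ) :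
    ((r - 2 * m : ℝ) : AddCircle (2:ℝ)) = (r : AddCircle (2:ℝ)) := by
  rw [← sub_eq_zero, ← AddCircle.coe_sub, AddCircle.coe_eq_zero_iff]
  exact ⟨-m, by simp; ring⟩

/-- The real number `r` represents a point of the arc `(1, 2)` of the circle. -/
def IsOut (r : ℝ) : Prop := ∃ m : ℤ, 1 < r - 2 * m ∧ r - 2 * m < 2

theorem isOut_of_one_lt_theta {r : ℝ} (h : ¬ θ (r : AddCircle (2:ℝ)) ≤ 1) : IsOut r := by
  obtain ⟨m, hm⟩ := exists_theta_coe r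
  have h2 := (theta_mem_Ico (r : AddCircle (2:ℝ))).2
  exact ⟨m, by linarith, by linarith⟩

theorem IsOut.not_theta_le_one {r : ℝ} (h : IsOut r) : ¬ θ (r : AddCircle (2:ℝ)) ≤ 1 := by
  obtain ⟨m, h1, h2⟩ := h
  rw [← coe_sub_two_mul r m, theta_coe_of_mem ⟨by linarith, h2⟩]
  linarith

/-- The displacement of a twist map. -/
def shift (y : AddCircle (2:ℝ)) : AddCircle (2:ℝ) :=
  if θ y ≤ 1 then ((2 * θ y : ℝ) : AddCircle (2:ℝ)) else 0

theorem continuous_shift : Continuous shift := by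
  let f : ℝ → AddCircle (2:ℝ) := fun r ↦ if r ≤ 1 then ((2 * r : ℝ) : AddCircle (2:ℝ)) else 0
  have hf : Continuous f := by
    refine Continuous.if_le ?_ continuous_const continuous_id continuous_const ?_
    · exact (AddCircle.continuous_mk' (2:ℝ)).comp (continuous_const.mul continuous_id)
    · rintro x hx
      have hx1 : x = 1 := hx
      rw [hx1, mul_one]
      exact AddCircle.coe_period (2:ℝ)
  have h := AddCircle.liftIco_zero_continuous (p := (2:ℝ)) (f := f) (by simp [f]) hf.continuousOn
  exact h

theorem F_eq (z : 𝕋) : F z = (z.1 + shift z.2, z.2) := by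
  unfold F shift
  split_ifs <;> simp

theorem G_eq (z : 𝕋) : G z = (z.1, z.2 + shift z.1) := by
  unfold G shift
  split_ifs <;> simp

theorem continuous_H : Continuous H := by
  have hF : Continuous F := by
    rw [funext F_eq]
    exact (continuous_fst.add (continuous_shift.comp continuous_snd)).prodMk continuous_snd
  have hG : Continuous G := by
    rw [funext G_eq]
    exact continuous_fst.prodMk (continuous_snd.add (continuous_shift.comp continuous_fst))
  exact hG.comp hF

theorem isClosed_theta_le_one : IsClosed {x : AddCircle (2:ℝ) | θ x ≤ 1} := by
  have h : {x : AddCircle (2:ℝ) | θ x ≤ 1} =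
      (fun r : ℝ ↦ (r : AddCircle (2:ℝ))) '' Set.Icc 0 1 := by
    ext x
    constructor
    · intro hx
      exact ⟨θ x, ⟨(theta_mem_Ico x).1, hx⟩, coe_theta x⟩
    · rintro ⟨r, hr, rfl⟩
      change θ _ ≤ 1
      rw [theta_coe_of_mem ⟨hr.1, by linarith [hr.2]⟩]
      exact hr.2
  rw [h]
  exact (isCompact_Icc.image (AddCircle.continuous_mk' (2:ℝ))).isClosed

theorem isOpen_theta_mem_Ioo : IsOpen {x : AddCircle (2:ℝ) | θ x ∈ Set.Ioo 0 1} := by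
  have h : {x : AddCircle (2:ℝ) | θ x ∈ Set.Ioo 0 1} =
      (fun r : ℝ ↦ (r : AddCircle (2:ℝ))) '' Set.Ioo 0 1 := by
    ext x
    constructor
    · intro hx
      exact ⟨θ x, hx, coe_theta x⟩
    · rintro ⟨r, hr, rfl⟩
      change θ _ ∈ Set.Ioo (0:ℝ) 1
      rwa [theta_coe_of_mem ⟨hr.1.le, by linarith [hr.2]⟩]
  rw [h]
  exact QuotientAddGroup.isOpenMap_coe _ isOpen_Ioo

theorem isClosed_S : IsClosed S :=
  (isClosed_theta_le_one.preimage continuous_snd).inter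
    (isClosed_theta_le_one.preimage continuous_fst)

/-- The open square inside `S`. -/
def openSquare : Set 𝕋 := {z | θ z.1 ∈ Set.Ioo 0 1 ∧ θ z.2 ∈ Set.Ioo 0 1}

theorem isOpen_openSquare : IsOpen openSquare :=
  (isOpen_theta_mem_Ioo.preimage continuous_fst).inter
    (isOpen_theta_mem_Ioo.preimage continuous_snd)

theorem openSquare_subset_S : openSquare ⊆ S := fun _ h ↦ ⟨h.2.2.le, h.1.2.le⟩

theorem rtn_eq {T : 𝕋 → 𝕋} {z : 𝕋} {i : ℕ} (hi : 1 ≤ i) (hS : T^[i] z ∈ S)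
    (hlt : ∀ j, 1 ≤ j → j < i → T^[j] z ∉ S) : rtn T z = i := by
  refine le_antisymm (Nat.sInf_le ⟨hi, hS⟩) ?_
  refine le_csInf ⟨i, hi, hS⟩ ?_
  rintro j ⟨hj, hjS⟩
  by_contra hji
  exact hlt j hj (not_le.mp hji) hjS

/-- Points of the singularity set lie on the boundary of the square or return to it. -/
theorem exists_return_to_boundary {z : 𝕋} (hz : z ∈ singSet) (hzo : z ∈ openSquare) :
    ∃ i, 1 ≤ i ∧ (∀ j, 1 ≤ j → j < i → H^[j] z ∉ S) ∧ H^[i] z ∈ S ∧ H^[i] z ∉ openSquare := by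
  by_contra! hcon
  obtain ⟨-, hz⟩ := hz
  simp only [Set.mem_iUnion, Set.mem_ofPred_eq] at hz
  obtain ⟨n, hn, hfr⟩ := hz
  have hcont : ∀ j, Continuous (H^[j]) := fun j ↦ continuous_H.iterate j
  have hout : ∀ i, (∀ j, 1 ≤ j → j < i → H^[j] z ∉ S) →
      ∀ᶠ w in nhds z, ∀ j, 1 ≤ j → j < i → H^[j] w ∉ S := by
    intro i hi
    have h : ∀ᶠ w in nhds z, ∀ j ∈ Finset.Ico 1 i, H^[j] w ∉ S := by
      rw [Filter.eventually_all_finset]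
      intro j hj
      rw [Finset.mem_Ico] at hj
      exact (hcont j).continuousAt.eventually (isClosed_S.isOpen_compl.mem_nhds (hi j hj.1 hj.2))
    filter_upwards [h] with w hw j hj1 hj2
    exact hw j (Finset.mem_Ico.mpr ⟨hj1, hj2⟩)
  by_cases hex : ∃ i, 1 ≤ i ∧ i ≤ n ∧ H^[i] z ∈ S
  · classical
    obtain ⟨hi1, hin, hiS⟩ := Nat.find_spec hex
    have hmin : ∀ j, 1 ≤ j → j < Nat.find hex → H^[j] z ∉ S := fun j hj hji hjS ↦
      Nat.find_min hex hji ⟨hj, hji.le.trans hin, hjS⟩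
    set i := Nat.find hex
    have hev : ∀ᶠ w in nhds z, w ∈ S ∧ rtn H w = i := by
      filter_upwards [isOpen_openSquare.mem_nhds hzo, hout i hmin,
        (hcont i).continuousAt.eventually
          (isOpen_openSquare.mem_nhds (hcon i hi1 hmin hiS))] with w h1 h2 h3
      exact ⟨openSquare_subset_S h1, rtn_eq hi1 (openSquare_subset_S h3) h2⟩
    by_cases hi : i = n
    · refine hfr.2 (mem_interior_iff_mem_nhds.mpr ?_)
      filter_upwards [hev] with w hw
      exact ⟨hw.1, hw.2.trans hi⟩
    · obtain ⟨w, hw, hw'⟩ := (mem_closure_iff_frequently.mp hfr.1 |>.and_eventually hev).exists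
      exact hi (hw'.2.symm.trans hw.2)
  · push Not at hex
    have hev := hout (n + 1) fun j hj hjn ↦ hex j hj (Nat.lt_succ_iff.mp hjn)
    obtain ⟨w, hw, hw'⟩ := (mem_closure_iff_frequently.mp hfr.1 |>.and_eventually hev).exists
    refine hw' n hn n.lt_succ_self ?_
    have hne : {m : ℕ | 1 ≤ m ∧ H^[m] w ∈ S}.Nonempty := by
      apply Nat.nonempty_of_pos_sInf
      have : rtn H w = n := hw.2
      unfold rtn at this
      omega
    have hmem := Nat.sInf_mem hne
    have hr : sInf {m : ℕ | 1 ≤ m ∧ H^[m] w ∈ S} = n := hw.2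
    rw [hr] at hmem
    exact hmem.2

theorem shift_coe_of_mem {r : ℝ} (h0 : 0 ≤ r) (h1 : r ≤ 1) :
    shift (r : AddCircle (2:ℝ)) = ((2 * r : ℝ) : AddCircle (2:ℝ)) := by
  have h : θ (r : AddCircle (2:ℝ)) = r := theta_coe_of_mem ⟨h0, by linarith⟩
  rw [shift, h, if_pos h1]

theorem IsOut.shift_eq_zero {r : ℝ} (h : IsOut r) : shift (r : AddCircle (2:ℝ)) = 0 :=
  if_neg h.not_theta_le_one

theorem H_coe_of_isOut_fst {x y : ℝ} (h0 : 0 ≤ y) (h1 : y ≤ 1) (h : IsOut (x + 2 * y)) :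
    H ((x : AddCircle (2:ℝ)), (y : AddCircle (2:ℝ))) =
      (((x + 2 * y : ℝ) : AddCircle (2:ℝ)), (y : AddCircle (2:ℝ))) := by
  rw [H, Function.comp_apply, F_eq, G_eq]
  simp only
  rw [shift_coe_of_mem h0 h1, ← AddCircle.coe_add, h.shift_eq_zero, add_zero]

theorem H_coe_of_mem {x y x' : ℝ} {m : ℤ} (h0 : 0 ≤ y) (h1 : y ≤ 1)
    (hx : x + 2 * y - 2 * m = x') (h0' : 0 ≤ x') (h1' : x' ≤ 1) :
    H ((x : AddCircle (2:ℝ)), (y : AddCircle (2:ℝ))) =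
      ((x' : AddCircle (2:ℝ)), ((y + 2 * x' : ℝ) : AddCircle (2:ℝ))) := by
  rw [H, Function.comp_apply, F_eq, G_eq]
  simp only
  rw [shift_coe_of_mem h0 h1, ← AddCircle.coe_add, ← coe_sub_two_mul _ m, hx,
    shift_coe_of_mem h0' h1', ← AddCircle.coe_add]

theorem H_coe_of_isOut_snd {x y : ℝ} (h0 : 0 ≤ x) (h1 : x ≤ 1) (h : IsOut y) :
    H ((x : AddCircle (2:ℝ)), (y : AddCircle (2:ℝ))) =
      ((x : AddCircle (2:ℝ)), ((y + 2 * x : ℝ) : AddCircle (2:ℝ))) := by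
  rw [H, Function.comp_apply, F_eq, G_eq]
  simp only
  rw [h.shift_eq_zero, add_zero, shift_coe_of_mem h0 h1, ← AddCircle.coe_add]

/-- Base points in the open unit square whose orbit `u, u + 2v, u + 4v, …` modulo `2` stays in the
arc `(1, 2)` until it hits an integer. -/
def excursionSet : Set (ℝ × ℝ) :=
  {p | p.1 ∈ Set.Ioo 0 1 ∧ p.2 ∈ Set.Ioo 0 1 ∧ ∃ k : ℕ, 1 ≤ k ∧ (∃ c : ℤ, p.1 + 2 * k * p.2 = c) ∧
    ∀ i : ℕ, 1 ≤ i → i < k → IsOut (p.1 + 2 * i * p.2)}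

theorem mem_Ioo_of_isOut {x y : ℝ} {k : ℕ} (hx : x ∈ Set.Ioo 0 1) (hy : y ∈ Set.Ioc 0 (1 / 2))
    (h : ∀ i : ℕ, 1 ≤ i → i < k → IsOut (x + 2 * i * y)) :
    ∀ i : ℕ, 1 ≤ i → i < k → x + 2 * i * y ∈ Set.Ioo 1 2 := by
  obtain ⟨hx0, hx1⟩ := hx
  obtain ⟨hy0, hy1⟩ := hy
  have key : ∀ r, 0 < r → r < 3 → IsOut r → r ∈ Set.Ioo (1:ℝ) 2 := by
    rintro r h0 h3 ⟨m, h1, h2⟩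
    have hm1 : (m : ℝ) < 1 := by linarith
    have hm2 : (-1 : ℝ) < m := by linarith
    have : m = 0 := by
      have a1 : m < 1 := by exact_mod_cast hm1
      have a2 : -1 < m := by exact_mod_cast hm2
      omega
    rw [this, Int.cast_zero, mul_zero, sub_zero] at h1 h2
    exact ⟨h1, h2⟩
  intro i hi
  induction i, hi using Nat.le_induction with
  | base =>
    intro hk
    have := h 1 le_rfl hk
    norm_num at this ⊢
    exact key _ (by linarith) (by linarith) this
  | succ n hn ih =>
    intro hk
    have h1 := ih (by omega)
    have := h (n + 1) (by omega) hk
    push_cast at this ⊢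
    exact key _ (by nlinarith [h1.1]) (by nlinarith [h1.2]) this

theorem IsOut.reflect {r : ℝ} (h : IsOut r) (n : ℤ) : IsOut (2 * n + 1 - r) := by
  obtain ⟨m, h1, h2⟩ := h
  refine ⟨n - m - 1, ?_, ?_⟩ <;> push_cast <;> linarith

theorem isOut_reflect_orbit {x y : ℝ} {k : ℕ}
    (h : ∀ i : ℕ, 1 ≤ i → i < k → IsOut (x + 2 * i * y)) :
    ∀ i : ℕ, 1 ≤ i → i < k → IsOut ((1 - x) + 2 * i * (1 - y)) := by
  intro i h1 h2
  have := (h i h1 h2).reflect i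
  push_cast at this
  convert this using 1
  ring

theorem reflect_mem_excursionSet {x y : ℝ} (h : (x, y) ∈ excursionSet) :
    (1 - x, 1 - y) ∈ excursionSet := by
  obtain ⟨hx, hy, k, hk, ⟨c, hc⟩, hout⟩ := h
  refine ⟨⟨by linarith [hx.2], by linarith [hx.1]⟩, ⟨by linarith [hy.2], by linarith [hy.1]⟩,
    k, hk, ⟨2 * k + 1 - c, ?_⟩, isOut_reflect_orbit hout⟩
  push_cast
  rw [← hc]
  ring

/-- After a long horizontal excursion the vertical coordinate returns at once. -/
theorem snd_mem_Ioo_of_long_excursion {x y x' : ℝ} {k : ℕ} {m : ℤ} (hx : x ∈ Set.Ioo 0 1)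
    (hy : y ∈ Set.Ioc 0 (1 / 2)) (hk : 5 ≤ k)
    (h : ∀ i : ℕ, 1 ≤ i → i < k → IsOut (x + 2 * i * y))
    (hx' : x + 2 * k * y - 2 * m = x') (h' : x' ∈ Set.Ioo 0 1) :
    y + 2 * x' ∈ Set.Ioo 0 1 := by
  have h1 := mem_Ioo_of_isOut hx hy h 1 le_rfl (by omega)
  have h2 := mem_Ioo_of_isOut hx hy h (k - 1) (by omega) (by omega)
  obtain ⟨hx0, hx1⟩ := hx
  obtain ⟨hy0, hy1⟩ := hy
  obtain ⟨hx'0, hx'1⟩ := h'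
  rw [Nat.cast_sub (by omega : 1 ≤ k)] at h2
  obtain ⟨h2a, h2b⟩ := h2
  have h1a := h1.1
  norm_num at h1a h2a h2b
  have hk' : (5:ℝ) ≤ k := by exact_mod_cast hk
  have hm : m = 1 := by
    have a1 : (m : ℝ) < 2 := by nlinarith
    have a2 : (0 : ℝ) < m := by nlinarith
    have b1 : m < 2 := by exact_mod_cast a1
    have b2 : 0 < m := by exact_mod_cast a2
    omega
  subst hm
  push_cast at hx'
  have hy6 : 6 * y < 1 := by nlinarith
  constructor <;> nlinarith

theorem snd_of_long_excursion {x y x' : ℝ} {k : ℕ} {m : ℤ} (hx : x ∈ Set.Ioo 0 1)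
    (hy : y ∈ Set.Ioo 0 1) (hk : 5 ≤ k)
    (h : ∀ i : ℕ, 1 ≤ i → i < k → IsOut (x + 2 * i * y))
    (hx' : x + 2 * k * y - 2 * m = x') (h' : x' ∈ Set.Ioo 0 1) :
    ∃ n : ℤ, y + 2 * x' - 2 * n ∈ Set.Ioo 0 1 := by
  rcases le_or_gt y (1 / 2) with hy2 | hy2
  · exact ⟨0, by simpa using snd_mem_Ioo_of_long_excursion hx ⟨hy.1, hy2⟩ hk h hx' h'⟩
  · have := snd_mem_Ioo_of_long_excursion (x := 1 - x) (y := 1 - y) (x' := 1 - x') (m := k - m)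
      ⟨by linarith [hx.2], by linarith [hx.1]⟩ ⟨by linarith [hy.2], by linarith⟩ hk
      (isOut_reflect_orbit h) (by push_cast; linarith) ⟨by linarith [h'.2], by linarith [h'.1]⟩
    exact ⟨1, by push_cast; linarith [this.2], by push_cast; linarith [this.1]⟩

theorem fst_coord_excursion {x y : ℝ} (hy : y ∈ Set.Ioo 0 1) (j : ℕ)
    (h : ∀ l : ℕ, 1 ≤ l → l ≤ j → IsOut (x + 2 * l * y)) :
    H^[j] ((x : AddCircle (2:ℝ)), (y : AddCircle (2:ℝ))) =
      (((x + 2 * j * y : ℝ) : AddCircle (2:ℝ)), (y : AddCircle (2:ℝ))) := by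
  induction j with
  | zero => simp
  | succ n ih =>
    have h1 := h (n + 1) (by omega) le_rfl
    have he : x + 2 * (n + 1 : ℕ) * y = x + 2 * n * y + 2 * y := by push_cast; ring
    rw [he] at h1 ⊢
    rw [Function.iterate_succ_apply', ih fun l hl hln ↦ h l hl (by omega),
      H_coe_of_isOut_fst hy.1.le hy.2.le h1]

theorem snd_coord_excursion {x y : ℝ} (hx0 : 0 ≤ x) (hx1 : x ≤ 1) (j : ℕ)
    (h : ∀ l : ℕ, 1 ≤ l → l ≤ j → IsOut (y + 2 * l * x)) :
    H^[j] ((x : AddCircle (2:ℝ)), ((y + 2 * x : ℝ) : AddCircle (2:ℝ))) =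
      ((x : AddCircle (2:ℝ)), ((y + 2 * (j + 1) * x : ℝ) : AddCircle (2:ℝ))) := by
  induction j with
  | zero => simp
  | succ n ih =>
    have h1 := h (n + 1) (by omega) le_rfl
    have he : y + 2 * ((n + 1 : ℕ) + 1) * x = y + 2 * (n + 1 : ℕ) * x + 2 * x := by ring
    rw [he, Function.iterate_succ_apply', ih fun l hl hln ↦ h l hl (by omega),
      ← Nat.cast_succ, H_coe_of_isOut_snd hx0 hx1 h1]

theorem theta_coe_le_one_of_mem {r : ℝ} (h0 : 0 ≤ r) (h1 : r ≤ 1) :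
    θ (r : AddCircle (2:ℝ)) ≤ 1 := by
  rwa [theta_coe_of_mem ⟨h0, by linarith⟩]

theorem eq_intCast_of_theta {r : ℝ} (h : θ (r : AddCircle (2:ℝ)) ≤ 1)
    (h' : θ (r : AddCircle (2:ℝ)) ∉ Set.Ioo 0 1) : ∃ c : ℤ, r = c := by
  obtain ⟨m, hm⟩ := exists_theta_coe r
  rcases (theta_mem_Ico (r : AddCircle (2:ℝ))).1.eq_or_lt with h0 | h0
  · exact ⟨2 * m, by push_cast; linarith⟩
  · rcases h.eq_or_lt with h1 | h1
    · exact ⟨2 * m + 1, by push_cast; linarith⟩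
    · exact absurd ⟨h0, h1⟩ h'

theorem singSet_subset_excursions {x y : ℝ} (hx : x ∈ Set.Ioo 0 1) (hy : y ∈ Set.Ioo 0 1)
    (h : ((x : AddCircle (2:ℝ)), (y : AddCircle (2:ℝ))) ∈ singSet) :
    (x, y) ∈ excursionSet ∨
      ∃ k ∈ Finset.range 5, ∃ m ∈ Finset.range 5, (y, x + 2 * k * y - 2 * m) ∈ excursionSet := by
  have hθx : θ (x : AddCircle (2:ℝ)) = x := theta_coe_of_mem ⟨hx.1.le, by linarith [hx.2]⟩
  have hθy : θ (y : AddCircle (2:ℝ)) = y := theta_coe_of_mem ⟨hy.1.le, by linarith [hy.2]⟩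
  obtain ⟨i, hi, hlt, hiS, hio⟩ := exists_return_to_boundary h
    ⟨by simpa only [hθx] using hx, by simpa only [hθy] using hy⟩
  have hex : ∃ k : ℕ, 1 ≤ k ∧ k ≤ i ∧ ¬ IsOut (x + 2 * k * y) := by
    by_contra! hcon
    rw [fst_coord_excursion hy i hcon] at hiS
    exact (hcon i hi le_rfl).not_theta_le_one hiS.2
  classical
  obtain ⟨hk1, hki, hkin⟩ := Nat.find_spec hex
  have hkmin : ∀ l : ℕ, 1 ≤ l → l < Nat.find hex → IsOut (x + 2 * l * y) := by
    intro l hl hlk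
    by_contra hcon
    exact Nat.find_min hex hlk ⟨hl, hlk.le.trans hki, hcon⟩
  generalize Nat.find hex = k at *
  have hθk : θ ((x + 2 * k * y : ℝ) : AddCircle (2:ℝ)) ≤ 1 := by
    by_contra hcon
    exact hkin (isOut_of_one_lt_theta hcon)
  obtain ⟨m, hm⟩ := exists_theta_coe (x + 2 * k * y)
  obtain ⟨x', hx'⟩ : ∃ x', x + 2 * k * y - 2 * m = x' := ⟨_, rfl⟩
  have hx'0 : 0 ≤ x' := by
    rw [← hx', ← hm]
    exact (theta_mem_Ico _).1
  have hx'1 : x' ≤ 1 := by rwa [← hx', ← hm]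
  by_cases hint : ∃ c : ℤ, x + 2 * k * y = c
  · exact Or.inl ⟨hx, hy, k, hk1, hint, hkmin⟩
  right
  have hx'o : x' ∈ Set.Ioo 0 1 := by
    by_contra hcon
    refine hint (eq_intCast_of_theta hθk ?_)
    rwa [hm, hx']
  have hHk : H^[k] ((x : AddCircle (2:ℝ)), (y : AddCircle (2:ℝ))) =
      ((x' : AddCircle (2:ℝ)), ((y + 2 * x' : ℝ) : AddCircle (2:ℝ))) := by
    obtain ⟨n, rfl⟩ : ∃ n, k = n + 1 := ⟨k - 1, by omega⟩
    rw [Function.iterate_succ_apply', fst_coord_excursion hy n fun l hl hln ↦ hkmin l hl (by omega)]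
    refine H_coe_of_mem (m := m) hy.1.le hy.2.le ?_ hx'0 hx'1
    rw [← hx']
    push_cast
    ring
  obtain ⟨j, rfl⟩ : ∃ j, i = j + k := ⟨i - k, by omega⟩
  have hout : ∀ l : ℕ, 1 ≤ l → l < j + 1 → IsOut (y + 2 * l * x') := by
    intro l
    induction l using Nat.strong_induction_on with
    | _ l ih =>
      intro hl hlj
      have h1 := hlt (l - 1 + k) (by omega) (by omega)
      rw [Function.iterate_add_apply, hHk, snd_coord_excursion hx'0 hx'1 (l - 1)
        fun a ha hal ↦ ih a (by omega) ha (by omega), Nat.cast_sub hl] at h1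
      norm_num at h1
      apply isOut_of_one_lt_theta
      intro hθ
      exact h1 ⟨hθ, theta_coe_le_one_of_mem hx'0 hx'1⟩
  rw [Function.iterate_add_apply, hHk, snd_coord_excursion hx'0 hx'1 j
    fun a ha hal ↦ hout a ha (by omega)] at hiS hio
  have hint' : ∃ c : ℤ, y + 2 * (j + 1 : ℕ) * x' = c := by
    push_cast
    refine eq_intCast_of_theta hiS.1 fun hθ ↦ hio ⟨?_, hθ⟩
    rwa [theta_coe_of_mem ⟨hx'0, by linarith⟩]
  have hmem : (y, x') ∈ excursionSet := ⟨hy, hx'o, j + 1, by omega, hint', hout⟩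
  have hk5 : k < 5 := by
    by_contra! hk5
    obtain ⟨n, hn0, hn1⟩ := snd_of_long_excursion hx hy hk5 hkmin hx' hx'o
    rcases Nat.eq_zero_or_pos j with rfl | hj
    · obtain ⟨c, hc⟩ := hint'
      norm_num at hc
      rw [hc] at hn0 hn1
      have a1 : 0 < c - 2 * n := by exact_mod_cast hn0
      have a2 : c - 2 * n < 1 := by exact_mod_cast hn1
      omega
    · obtain ⟨p, hp1, hp2⟩ := hout 1 le_rfl (by omega)
      norm_num at hp1 hp2
      have a1 : ((p - n : ℤ) : ℝ) < 0 := by push_cast; linarith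
      have a2 : (-1 : ℝ) < ((p - n : ℤ) : ℝ) := by push_cast; linarith
      have b1 : p - n < 0 := by exact_mod_cast a1
      have b2 : -1 < p - n := by exact_mod_cast a2
      omega
  have hk4 : (k : ℝ) ≤ 4 := by exact_mod_cast Nat.lt_succ_iff.mp hk5
  have hk0 : (0 : ℝ) ≤ k := k.cast_nonneg
  have hm0 : 0 ≤ m := by
    have : (-1 : ℝ) < m := by nlinarith [hx.1, hy.1, hx'o.2, mul_nonneg hk0 hy.1.le]
    have : -1 < m := by exact_mod_cast this
    omega
  have hm5 : m < 5 := by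
    have : (m : ℝ) < 5 := by
      nlinarith [hx.2, hx'o.1, mul_nonneg hk0 (sub_nonneg.mpr hy.2.le)]
    exact_mod_cast this
  lift m to ℕ using hm0
  refine ⟨k, Finset.mem_range.mpr hk5, m, Finset.mem_range.mpr (by exact_mod_cast hm5), ?_⟩
  rw [Int.cast_natCast] at hx'
  rwa [hx']

theorem excursion_segment {u v : ℝ} (h : (u, v) ∈ excursionSet) (hv : v ≤ 1 / 2) :
    u + 2 * v = 1 ∨ ∃ n : ℕ, 1 ≤ n ∧ u + 2 * (n + 1) * v = 2 ∧ 1 - u < 1 / n ∧ v < 1 / n / 2 := by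
  obtain ⟨hu, hv', k, hk, ⟨c, hc⟩, hout⟩ := h
  have hmem := mem_Ioo_of_isOut hu ⟨hv'.1, hv⟩ hout
  simp only at hu hv' hc hmem
  obtain ⟨n, rfl⟩ : ∃ n, k = n + 1 := ⟨k - 1, by omega⟩
  rcases Nat.eq_zero_or_pos n with rfl | hn
  · left
    norm_num at hc
    have h1 : (0 : ℝ) < c := by linarith [hu.1, hv'.1]
    have h2 : (c : ℝ) < 2 := by linarith [hu.2]
    have h1' : 0 < c := by exact_mod_cast h1
    have h2' : c < 2 := by exact_mod_cast h2
    have hc1 : c = 1 := by omega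
    rw [hc, hc1, Int.cast_one]
  · right
    have h1 := (hmem 1 le_rfl (by omega)).1
    have h2 := hmem n hn (by omega)
    norm_num at h1
    push_cast at hc
    have hn0 : (1 : ℝ) ≤ n := by exact_mod_cast hn
    have hc1 : (1 : ℝ) < c := by nlinarith [h2.1, hv'.1]
    have hc3 : (c : ℝ) < 3 := by nlinarith [h2.2, hv'.1]
    have hc1' : 1 < c := by exact_mod_cast hc1
    have hc3' : c < 3 := by exact_mod_cast hc3
    have hc2 : c = 2 := by omega
    rw [hc2] at hc
    push_cast at hc
    have hnv : 2 * n * v < 1 := by linarith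
    refine ⟨n, hn, hc, ?_, ?_⟩
    · rw [lt_div_iff₀ (by linarith)]
      nlinarith
    · rw [div_div, lt_div_iff₀ (by linarith)]
      linarith

theorem measurePreserving_shear {g : ℝ → ℝ} (hg : Measurable g) :
    MeasurePreserving (fun p : ℝ × ℝ ↦ (p.1, p.2 + g p.1)) := by
  refine (MeasurePreserving.id (volume : Measure ℝ)).skew_product (μc := volume) (μd := volume)
    (g := fun a c ↦ c + g a) ?_ ?_
  · exact measurable_snd.add (hg.comp measurable_fst)
  · exact Filter.Eventually.of_forall fun a ↦ (measurePreserving_add_right volume (g a)).map_eq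

theorem volume_box (a b c d : ℝ) (hab : a ≤ b) :
    volume (Set.Icc a b ×ˢ Set.Icc c d) = ENNReal.ofReal ((b - a) * (d - c)) := by
  rw [Measure.volume_eq_prod, Measure.prod_prod, Real.volume_Icc, Real.volume_Icc,
    ENNReal.ofReal_mul (by linarith)]

/-- A strip around the line `p.1 + l * p.2 = c`, over the interval `[a, b]`. -/
def strip (a b l c δ : ℝ) : Set (ℝ × ℝ) := {p | p.1 ∈ Set.Icc a b ∧ |p.1 + l * p.2 - c| ≤ δ}

theorem volume_strip {a b l c δ : ℝ} (hab : a ≤ b) (hl : 0 < l) :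
    volume (strip a b l c δ) = ENNReal.ofReal ((b - a) * (2 * δ / l)) := by
  have hpre : strip a b l c δ = (fun p : ℝ × ℝ ↦ (p.1, p.2 + p.1 / l)) ⁻¹'
      (Set.Icc a b ×ˢ Set.Icc ((c - δ) / l) ((c + δ) / l)) := by
    ext ⟨x, y⟩
    simp only [strip, Set.mem_ofPred_eq, Set.mem_preimage, Set.mem_prod, Set.mem_Icc, abs_le,
      div_le_iff₀ hl, le_div_iff₀ hl, add_mul, div_mul_cancel₀ _ hl.ne']
    constructor
    · rintro ⟨h1, h2, h3⟩
      exact ⟨h1, by linarith, by linarith⟩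
    · rintro ⟨h1, h2, h3⟩
      exact ⟨h1, by linarith, by linarith⟩
  rw [hpre, (measurePreserving_shear (measurable_id'.div_const l)).measure_preimage
    (measurableSet_Icc.prod measurableSet_Icc).nullMeasurableSet, volume_box _ _ _ _ hab]
  congr 1
  ring

/-- The part of `excursionSet` in the lower half of the square. -/
def lowExcursionSet : Set (ℝ × ℝ) := {p ∈ excursionSet | p.2 ≤ 1 / 2}

theorem abs_of_dist_lt {z w : ℝ × ℝ} {ε : ℝ} (h : dist z w < ε) :
    |z.1 - w.1| < ε ∧ |z.2 - w.2| < ε := by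
  rwa [Prod.dist_eq, max_lt_iff, Real.dist_eq, Real.dist_eq] at h

theorem thickening_lowExcursionSet_subset {ε : ℝ} (h1 : ε ≤ 1) {N : ℕ} (hN : 1 / N ≤ ε)
    (hN1 : 1 ≤ N) :
    Metric.thickening ε lowExcursionSet ⊆
      (strip (-1) 2 2 1 (3 * ε) ∪ Set.Icc (1 - 2 * ε) (1 + ε) ×ˢ Set.Icc (-ε) (2 * ε)) ∪
      ⋃ n ∈ Finset.Icc 1 N, strip (1 - 1 / n - ε) (1 + ε) (2 * (n + 1)) 2 ((2 * n + 3) * ε) := by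
  intro z hz
  rw [Metric.mem_thickening_iff] at hz
  obtain ⟨w, ⟨hw, hw2⟩, hd⟩ := hz
  obtain ⟨hd1, hd2⟩ := abs_of_dist_lt hd
  rw [abs_lt] at hd1 hd2
  obtain ⟨hw1, hwv, -⟩ := id hw
  rcases excursion_segment (u := w.1) (v := w.2) hw hw2 with hs | ⟨n, hn, hs, hu, hv⟩
  · left; left
    refine ⟨⟨by linarith [hw1.1], by linarith [hw1.2]⟩, ?_⟩
    rw [abs_le]
    constructor <;> linarith
  · by_cases hnN : n ≤ N
    · right
      simp only [Set.mem_iUnion]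
      refine ⟨n, Finset.mem_Icc.mpr ⟨hn, hnN⟩, ⟨by linarith, by linarith [hw1.2]⟩, ?_⟩
      have hn0 : (0 : ℝ) ≤ n := n.cast_nonneg
      rw [abs_le]
      constructor <;> nlinarith
    · left; right
      have hle : (1 : ℝ) / n ≤ 1 / N := by
        apply one_div_le_one_div_of_le
        · exact_mod_cast hN1
        · exact_mod_cast (not_le.mp hnN).le
      have h0 : 0 < ε := by linarith
      exact ⟨⟨by linarith, by linarith [hw1.2]⟩, ⟨by linarith [hwv.1], by linarith⟩⟩

theorem volume_thickening_lowExcursionSet_le_log {ε : ℝ} (h0 : 0 < ε) (h1 : ε ≤ 1) :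
    volume (Metric.thickening ε lowExcursionSet) ≤
      ENNReal.ofReal (33 * ε + 3 * ε * Real.log (2 / ε)) := by
  set N := ⌈1 / ε⌉₊
  have hNε : 1 / ε ≤ N := Nat.le_ceil _
  have hN0 : (0 : ℝ) < N := (one_div_pos.mpr h0).trans_le hNε
  have hN1 : 1 ≤ N := by exact_mod_cast hN0
  have hN : 1 / (N : ℝ) ≤ ε := by rwa [one_div_le hN0 h0]
  have hN2 : (N : ℝ) ≤ 2 / ε := by
    have h2 : (N : ℝ) < 1 / ε + 1 := Nat.ceil_lt_add_one (one_div_pos.mpr h0).le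
    have h3 : 1 ≤ 1 / ε := by rwa [le_one_div one_pos h0, div_one]
    have h4 : 2 / ε = 1 / ε + 1 / ε := by ring
    linarith
  have hlog : Real.log N ≤ Real.log (2 / ε) := Real.log_le_log hN0 hN2
  have hharm : ∑ n ∈ Finset.Icc 1 N, (1 : ℝ) / n ≤ 1 + Real.log N := by
    have h := harmonic_le_one_add_log N
    rw [harmonic_eq_sum_Icc] at h
    push_cast at h
    simpa only [one_div] using h
  have hterm : ∀ n ∈ Finset.Icc 1 N,
      volume (strip (1 - 1 / n - ε) (1 + ε) (2 * (n + 1)) 2 ((2 * n + 3) * ε)) ≤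
        ENNReal.ofReal (3 * ε * (1 / n) + 6 * ε ^ 2) := by
    intro n _
    have hn : (0 : ℝ) ≤ 1 / n := by positivity
    have hn' : (0 : ℝ) ≤ n := n.cast_nonneg
    rw [volume_strip (by linarith) (by positivity)]
    apply ENNReal.ofReal_le_ofReal
    have hq : 2 * ((2 * n + 3) * ε) / (2 * ((n : ℝ) + 1)) ≤ 3 * ε := by
      rw [div_le_iff₀ (by positivity)]
      nlinarith [mul_nonneg hn' h0.le]
    calc (1 + ε - (1 - 1 / n - ε)) * (2 * ((2 * n + 3) * ε) / (2 * ((n : ℝ) + 1)))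
        ≤ (1 + ε - (1 - 1 / n - ε)) * (3 * ε) :=
          mul_le_mul_of_nonneg_left hq (by linarith)
      _ = 3 * ε * (1 / n) + 6 * ε ^ 2 := by ring
  have hsum : ∑ n ∈ Finset.Icc 1 N, ((3 * ε) * ((1 : ℝ) / n) + 6 * ε ^ 2) ≤
      15 * ε + 3 * ε * Real.log (2 / ε) := by
    rw [Finset.sum_add_distrib, ← Finset.mul_sum, Finset.sum_const, Nat.card_Icc,
      Nat.add_sub_cancel, nsmul_eq_mul]
    have h2 : (N : ℝ) * ε ≤ 2 := by rwa [le_div_iff₀ h0] at hN2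
    nlinarith
  refine (measure_mono (thickening_lowExcursionSet_subset h1 hN hN1)).trans ?_
  refine (measure_union_le _ _).trans ?_
  have hA : volume (strip (-1) 2 2 1 (3 * ε)) = ENNReal.ofReal (9 * ε) := by
    rw [volume_strip (by norm_num) (by norm_num)]
    congr 1
    ring
  have hB : volume (Set.Icc (1 - 2 * ε) (1 + ε) ×ˢ Set.Icc (-ε) (2 * ε)) ≤
      ENNReal.ofReal (9 * ε) := by
    rw [volume_box _ _ _ _ (by linarith)]
    exact ENNReal.ofReal_le_ofReal (by nlinarith)
  have hU : volume (⋃ n ∈ Finset.Icc 1 N,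
      strip (1 - 1 / n - ε) (1 + ε) (2 * (n + 1)) 2 ((2 * n + 3) * ε)) ≤
      ENNReal.ofReal (15 * ε + 3 * ε * Real.log (2 / ε)) := by
    refine (measure_biUnion_finset_le _ _).trans ((Finset.sum_le_sum hterm).trans ?_)
    rw [← ENNReal.ofReal_sum_of_nonneg fun n _ ↦ by positivity]
    exact ENNReal.ofReal_le_ofReal hsum
  have hlog0 : 0 ≤ Real.log (2 / ε) :=
    Real.log_nonneg (by rw [le_div_iff₀ h0]; linarith)
  calc _ ≤ (ENNReal.ofReal (9 * ε) + ENNReal.ofReal (9 * ε)) +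
        ENNReal.ofReal (15 * ε + 3 * ε * Real.log (2 / ε)) :=
        add_le_add ((measure_union_le _ _).trans (add_le_add hA.le hB)) hU
    _ = ENNReal.ofReal (33 * ε + 3 * ε * Real.log (2 / ε)) := by
        rw [← ENNReal.ofReal_add (by positivity) (by positivity),
          ← ENNReal.ofReal_add (by positivity) (by positivity)]
        congr 1
        ring

theorem exists_volume_thickening_excursionSet_le {a : ℝ} (ha1 : a < 1) :
    ∃ C : ℝ, 0 < C ∧ ∀ ε : ℝ, 0 < ε → ε ≤ 1 →
      volume (Metric.thickening ε excursionSet) ≤ ENNReal.ofReal (C * ε ^ a) := by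
  have hs : 0 < 1 - a := by linarith
  set C := 33 + 3 * (2 ^ (1 - a) / (1 - a)) with hC
  have hC0 : 0 < C := by positivity
  refine ⟨2 * C, by positivity, fun ε h0 h1 ↦ ?_⟩
  have hle : ε ≤ ε ^ a := by
    simpa using Real.rpow_le_rpow_of_exponent_ge h0 h1 ha1.le
  have hlog : Real.log (2 / ε) ≤ (2 / ε) ^ (1 - a) / (1 - a) :=
    Real.log_le_rpow_div (by positivity) hs
  have heq : ε * ((2 / ε) ^ (1 - a) / (1 - a)) = (2 ^ (1 - a) / (1 - a)) * ε ^ a := by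
    rw [Real.div_rpow (by norm_num) h0.le]
    have : ε = ε ^ a * ε ^ (1 - a) := by
      rw [← Real.rpow_add h0]
      simp
    have hp : 0 < ε ^ (1 - a) := Real.rpow_pos_of_pos h0 _
    nth_rewrite 1 [this]
    field_simp
  have hlow : volume (Metric.thickening ε lowExcursionSet) ≤ ENNReal.ofReal (C * ε ^ a) := by
    refine (volume_thickening_lowExcursionSet_le_log h0 h1).trans (ENNReal.ofReal_le_ofReal ?_)
    have := mul_le_mul_of_nonneg_left hlog h0.le
    rw [heq] at this
    rw [hC]
    linarith
  have hrefl : MeasurePreserving (fun p : ℝ × ℝ ↦ (1 - p.1, 1 - p.2)) :=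
    (Measure.measurePreserving_sub_left volume (1 : ℝ)).prod (Measure.measurePreserving_sub_left volume (1 : ℝ))
  have hsub : Metric.thickening ε excursionSet ⊆ Metric.thickening ε lowExcursionSet ∪
      (fun p : ℝ × ℝ ↦ (1 - p.1, 1 - p.2)) ⁻¹' Metric.thickening ε lowExcursionSet := by
    intro z hz
    rw [Metric.mem_thickening_iff] at hz
    obtain ⟨w, hw, hd⟩ := hz
    rcases le_or_gt w.2 (1 / 2) with hw2 | hw2
    · exact Or.inl (Metric.mem_thickening_iff.mpr ⟨w, ⟨hw, hw2⟩, hd⟩)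
    · refine Or.inr (Metric.mem_thickening_iff.mpr ⟨(1 - w.1, 1 - w.2),
        ⟨reflect_mem_excursionSet hw, by simp only; linarith⟩, ?_⟩)
      simpa only [Prod.dist_eq, dist_sub_left] using hd
  refine (measure_mono hsub).trans ((measure_union_le _ _).trans ?_)
  rw [hrefl.measure_preimage Metric.isOpen_thickening.measurableSet.nullMeasurableSet, mul_assoc,
    two_mul, ENNReal.ofReal_add (by positivity) (by positivity)]
  exact add_le_add hlow hlow

theorem measurePreserving_mk_prod :
    MeasurePreserving (fun p : ℝ × ℝ ↦ (((p.1 : AddCircle (2:ℝ)), (p.2 : AddCircle (2:ℝ))) : 𝕋))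
      (volume.restrict (Set.Ioc (-1) 1 ×ˢ Set.Ioc (-1) 1)) := by
  have h := AddCircle.measurePreserving_mk (2:ℝ) (-1)
  norm_num at h
  have h2 := h.prod h
  rwa [Measure.prod_restrict] at h2

theorem mem_Icc_of_theta_le_one {r : ℝ} (hr : r ∈ Set.Ioc (-1) 1)
    (h : θ (r : AddCircle (2:ℝ)) ≤ 1) : r ∈ Set.Icc 0 1 := by
  refine ⟨?_, hr.2⟩
  by_contra! h0
  exact IsOut.not_theta_le_one ⟨-1, by push_cast; linarith [hr.1], by push_cast; linarith⟩ h

theorem abs_sub_lt_of_dist_coe {r s ε : ℝ} (hr : r ∈ Set.Icc 0 1) (hs : s ∈ Set.Icc 0 1)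
    (h : dist (r : AddCircle (2:ℝ)) (s : AddCircle (2:ℝ)) < ε) : |r - s| < ε := by
  rw [dist_eq_norm, ← AddCircle.coe_sub] at h
  have hle : |r - s| ≤ |(2:ℝ)| / 2 := by
    rw [abs_le]
    norm_num
    constructor <;> linarith [hr.1, hr.2, hs.1, hs.2]
  rwa [(AddCircle.norm_coe_eq_abs_iff (2:ℝ) two_ne_zero).mpr hle] at h

theorem measurePreserving_iterated_shear (k m : ℕ) :
    MeasurePreserving (fun p : ℝ × ℝ ↦ (p.2, p.1 + 2 * k * p.2 - 2 * m)) := by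
  have h := (measurePreserving_shear (g := fun v ↦ 2 * k * v - 2 * m) (by fun_prop)).comp
    (Measure.measurePreserving_swap (μ := (volume : Measure ℝ)) (ν := (volume : Measure ℝ)))
  convert h using 2 with p
  · simp [add_sub_assoc]
  · rfl

/-- The `ε`-neighbourhood of the boundary of the unit square, inside the square. -/
def collar (ε : ℝ) : Set (ℝ × ℝ) :=
  (Set.Icc 0 ε ×ˢ Set.Icc 0 1 ∪ Set.Icc (1 - ε) 1 ×ˢ Set.Icc 0 1) ∪
    (Set.Icc 0 1 ×ˢ Set.Icc 0 ε ∪ Set.Icc 0 1 ×ˢ Set.Icc (1 - ε) 1)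

theorem volume_collar_le {ε : ℝ} (h0 : 0 < ε) : volume (collar ε) ≤ ENNReal.ofReal (4 * ε) := by
  refine (measure_union_le _ _).trans ((add_le_add (measure_union_le _ _)
    (measure_union_le _ _)).trans ?_)
  rw [volume_box _ _ _ _ h0.le, volume_box _ _ _ _ (by linarith), volume_box _ _ _ _ zero_le_one,
    volume_box _ _ _ _ zero_le_one, ← ENNReal.ofReal_add (by linarith) (by linarith),
    ← ENNReal.ofReal_add (by linarith) (by linarith),
    ← ENNReal.ofReal_add (by linarith) (by linarith)]
  apply ENNReal.ofReal_le_ofReal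
  linarith

theorem preimage_thickening_singSet_subset (ε : ℝ) :
    (fun p : ℝ × ℝ ↦ (((p.1 : AddCircle (2:ℝ)), (p.2 : AddCircle (2:ℝ))) : 𝕋)) ⁻¹'
        (S ∩ Metric.thickening ε singSet) ∩ Set.Ioc (-1) 1 ×ˢ Set.Ioc (-1) 1 ⊆
      (collar ε ∪ Metric.thickening ε excursionSet) ∪
      ⋃ k ∈ Finset.range 5, ⋃ m ∈ Finset.range 5,
        (fun p : ℝ × ℝ ↦ (p.2, p.1 + 2 * (k : ℕ) * p.2 - 2 * (m : ℕ))) ⁻¹'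
          Metric.thickening (9 * ε) excursionSet := by
  rintro ⟨p, q⟩ ⟨⟨⟨hq, hp⟩, hz⟩, hp', hq'⟩
  simp only at hp' hq'
  have hp1 := mem_Icc_of_theta_le_one hp' hp
  have hq1 := mem_Icc_of_theta_le_one hq' hq
  rw [Metric.mem_thickening_iff] at hz
  obtain ⟨⟨w1, w2⟩, hw, hd⟩ := hz
  have hwS := hw.1
  obtain ⟨x, hx, hxw⟩ : ∃ x : ℝ, x ∈ Set.Icc 0 1 ∧ (x : AddCircle (2:ℝ)) = w1 :=
    ⟨θ w1, ⟨(theta_mem_Ico w1).1, hwS.2⟩, coe_theta w1⟩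
  obtain ⟨y, hy, hyw⟩ : ∃ y : ℝ, y ∈ Set.Icc 0 1 ∧ (y : AddCircle (2:ℝ)) = w2 :=
    ⟨θ w2, ⟨(theta_mem_Ico w2).1, hwS.1⟩, coe_theta w2⟩
  subst hxw hyw
  rw [Prod.dist_eq, max_lt_iff] at hd
  have hd1 := abs_sub_lt_of_dist_coe hp1 hx hd.1
  have hd2 := abs_sub_lt_of_dist_coe hq1 hy hd.2
  have hε : 0 < ε := (abs_nonneg _).trans_lt hd1
  have hd1' := abs_lt.mp hd1
  have hd2' := abs_lt.mp hd2
  by_cases hxo : x ∈ Set.Ioo 0 1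
  swap
  · refine Or.inl (Or.inl (Or.inl ?_))
    rcases hx.1.eq_or_lt with h | h
    · exact Or.inl ⟨⟨hp1.1, by simp only; linarith⟩, hq1⟩
    · rcases hx.2.eq_or_lt with h' | h'
      · exact Or.inr ⟨⟨by simp only; linarith, hp1.2⟩, hq1⟩
      · exact absurd ⟨h, h'⟩ hxo
  by_cases hyo : y ∈ Set.Ioo 0 1
  swap
  · refine Or.inl (Or.inl (Or.inr ?_))
    rcases hy.1.eq_or_lt with h | h
    · exact Or.inl ⟨hp1, hq1.1, by simp only; linarith⟩
    · rcases hy.2.eq_or_lt with h' | h'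
      · exact Or.inr ⟨hp1, by simp only; linarith, hq1.2⟩
      · exact absurd ⟨h, h'⟩ hyo
  rcases singSet_subset_excursions hxo hyo hw with h | ⟨k, hk, m, hm, h⟩
  · refine Or.inl (Or.inr (Metric.mem_thickening_iff.mpr ⟨_, h, ?_⟩))
    rw [Prod.dist_eq, max_lt_iff, Real.dist_eq, Real.dist_eq]
    exact ⟨hd1, hd2⟩
  · refine Or.inr ?_
    simp only [Set.mem_iUnion]
    refine ⟨k, hk, m, hm, Metric.mem_thickening_iff.mpr ⟨_, h, ?_⟩⟩
    rw [Prod.dist_eq, max_lt_iff, Real.dist_eq, Real.dist_eq]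
    refine ⟨by simp only; linarith, ?_⟩
    have hk4 : (k : ℝ) ≤ 4 := by
      exact_mod_cast Nat.lt_succ_iff.mp (Finset.mem_range.mp hk)
    have hk0 : (0 : ℝ) ≤ k := k.cast_nonneg
    simp only
    rw [abs_lt]
    constructor <;> nlinarith

/-- The singularity set of `H_S` is metrically thin (condition KS1). -/
theorem singularity_set_thin :
    ∀ a : ℝ, 0 < a → a < 1 → ∃ C : ℝ, 0 < C ∧ ∀ ε : ℝ, 0 < ε →
      (volume : Measure 𝕋) (S ∩ Metric.thickening ε singSet) ≤ ENNReal.ofReal (C * ε ^ a) := by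
  intro a ha0 ha1
  obtain ⟨C₁, hC₁, hthin⟩ := exists_volume_thickening_excursionSet_le ha1
  set V := (volume (Set.univ : Set 𝕋)).toReal
  have hV : 0 ≤ V := ENNReal.toReal_nonneg
  have h9 : 0 < (9 : ℝ) ^ a := Real.rpow_pos_of_pos (by norm_num) _
  refine ⟨V * 9 ^ a + (4 + C₁ + 25 * (C₁ * 9 ^ a)), by positivity, fun ε h0 ↦ ?_⟩
  have hεa : 0 < ε ^ a := Real.rpow_pos_of_pos h0 _
  rcases le_or_gt (1 : ℝ) (9 * ε) with hε | hε
  · refine (measure_mono (Set.subset_univ _)).trans ?_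
    rw [← ENNReal.ofReal_toReal (measure_ne_top (volume : Measure 𝕋) Set.univ)]
    apply ENNReal.ofReal_le_ofReal
    have h1 : 1 ≤ (9 : ℝ) ^ a * ε ^ a := by
      rw [← Real.mul_rpow (by norm_num) h0.le]
      exact Real.one_le_rpow hε ha0.le
    have h2 : 0 ≤ (4 + C₁ + 25 * (C₁ * 9 ^ a)) * ε ^ a := by positivity
    change V ≤ _
    nlinarith
  · have hmeas : MeasurableSet (S ∩ Metric.thickening ε singSet) :=
      isClosed_S.measurableSet.inter Metric.isOpen_thickening.measurableSet
    rw [← measurePreserving_mk_prod.measure_preimage hmeas.nullMeasurableSet,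
      Measure.restrict_apply (measurePreserving_mk_prod.measurable hmeas)]
    refine (measure_mono (preimage_thickening_singSet_subset ε)).trans ?_
    have hpre : ∀ k m : ℕ, volume ((fun p : ℝ × ℝ ↦ (p.2, p.1 + 2 * k * p.2 - 2 * m)) ⁻¹'
        Metric.thickening (9 * ε) excursionSet) ≤ ENNReal.ofReal (C₁ * 9 ^ a * ε ^ a) := by
      intro k m
      rw [(measurePreserving_iterated_shear k m).measure_preimage
        Metric.isOpen_thickening.measurableSet.nullMeasurableSet, mul_assoc,
        ← Real.mul_rpow (by norm_num) h0.le]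
      exact hthin (9 * ε) (by linarith) hε.le
    have hle : ε ≤ ε ^ a := by
      simpa using Real.rpow_le_rpow_of_exponent_ge h0 (by linarith) ha1.le
    calc _ ≤ (ENNReal.ofReal (4 * ε) + ENNReal.ofReal (C₁ * ε ^ a)) +
          ∑ k ∈ Finset.range 5, ∑ m ∈ Finset.range 5, ENNReal.ofReal (C₁ * 9 ^ a * ε ^ a) := by
          refine (measure_union_le _ _).trans (add_le_add ((measure_union_le _ _).trans
            (add_le_add (volume_collar_le h0) (hthin ε h0 (by linarith)))) ?_)
          refine (measure_biUnion_finset_le _ _).trans (Finset.sum_le_sum fun k _ ↦ ?_)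
          exact (measure_biUnion_finset_le _ _).trans (Finset.sum_le_sum fun m _ ↦ hpre k m)
      _ = ENNReal.ofReal (4 * ε + C₁ * ε ^ a +
          ∑ k ∈ Finset.range 5, ∑ m ∈ Finset.range 5, C₁ * 9 ^ a * ε ^ a) := by
          rw [ENNReal.ofReal_add (by positivity) (by positivity),
            ENNReal.ofReal_add (by positivity) (by positivity),
            ENNReal.ofReal_sum_of_nonneg fun k _ ↦ by positivity]
          simp_rw [ENNReal.ofReal_sum_of_nonneg
            (fun m (_ : m ∈ Finset.range 5) ↦ (by positivity : 0 ≤ C₁ * 9 ^ a * ε ^ a))]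
      _ ≤ _ := by
          apply ENNReal.ofReal_le_ofReal
          simp only [Finset.sum_const, Finset.card_range, nsmul_eq_mul]
          have h2 : 0 ≤ V * 9 ^ a * ε ^ a := by positivity
          push_cast
          linarith
end
end

section
/- The Lebesgue measure of an ε-neighbourhood of a family of segments of length ~1/n accumulating at a corner is of order ε log(1/ε): in ℝ², let Γ = ⋃_{n ≥ 2} segment ℝ (((n-2)/(n-1) : ℝ), 1/(2*(n-1))) ((1 : ℝ), 1/(2*n)) (the union over natural numbers n ≥ 2 of the closed line segments joining ((n-2)/(n-1), 1/(2(n-1))) to (1, 1/(2n))). Then there exists C > 0 such that for every ε with 0 < ε < 1/2, (volume (Metric.thickening ε Γ)).toReal ≤ C * ε * Real.log (1/ε). -/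
open MeasureTheory

noncomputable section

/-- The union of the segments of the singularity set of the return map of the twist `F`
accumulating at the corner `(1, 0)`. -/
def Γ : Set (ℝ × ℝ) :=
  ⋃ n ∈ {n : ℕ | 2 ≤ n},
    segment ℝ ((((n : ℝ) - 2) / ((n : ℝ) - 1), 1 / (2 * ((n : ℝ) - 1))))
      (((1 : ℝ), 1 / (2 * (n : ℝ))))

/-- A strip of vertical half-width `δ` around the graph of a measurable function over an interval
has area at most its width times `2 * δ`. -/
lemma volume_graph_strip_le {f : ℝ → ℝ} (hf : Measurable f) (a b δ : ℝ) :
    volume {z : ℝ × ℝ | z.1 ∈ Set.Ioo a b ∧ |z.2 - f z.1| < δ} ≤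
      ENNReal.ofReal (2 * δ) * ENNReal.ofReal (b - a) := by
  have hset : {z : ℝ × ℝ | z.1 ∈ Set.Ioo a b ∧ |z.2 - f z.1| < δ} =
      regionBetween (fun x => f x - δ) (fun x => f x + δ) (Set.Ioo a b) := by
    ext z
    simp only [regionBetween, Set.mem_ofPred_eq, abs_lt, Set.mem_Ioo]
    constructor <;> rintro ⟨h, h₁, h₂⟩ <;> exact ⟨h, by linarith, by linarith⟩
  rw [hset, Measure.volume_eq_prod, volume_regionBetween_eq_lintegral
    (hf.sub_const δ).aemeasurable (hf.add_const δ).aemeasurable measurableSet_Ioo]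
  have hconst : ∀ x, ENNReal.ofReal
      (((fun x => f x + δ) - fun x => f x - δ : ℝ → ℝ) x) = ENNReal.ofReal (2 * δ) := by
    intro x
    congr 1
    simp only [Pi.sub_apply]
    ring
  simp only [hconst, lintegral_const, Measure.restrict_apply_univ, Real.volume_Ioo, le_refl]

/-- Every point of `Γ` lies, for some `k`, on the line `y = (2 - x) / (2 * (k + 2))` and within
explicit bounds. -/
lemma exists_line_of_mem_Γ {w : ℝ × ℝ} (hw : w ∈ Γ) :
    ∃ k : ℕ, 1 - 1 / ((k : ℝ) + 1) ≤ w.1 ∧ w.1 ≤ 1 ∧ 0 ≤ w.2 ∧ w.2 ≤ 1 / ((k : ℝ) + 1) ∧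
      w.2 = (2 - w.1) / (2 * ((k : ℝ) + 2)) := by
  simp only [Γ, Set.mem_iUnion, Set.mem_ofPred_eq] at hw
  obtain ⟨n, hn, a, b, ha, hb, hab, rfl⟩ := hw
  obtain ⟨k, rfl⟩ := Nat.exists_eq_add_of_le' hn
  obtain rfl : b = 1 - a := by linarith
  have hk : (0 : ℝ) ≤ k := k.cast_nonneg
  have e : ((k + 2 : ℕ) : ℝ) - 1 = k + 1 := by push_cast; ring
  simp only [e, Prod.smul_mk, Prod.mk_add_mk, smul_eq_mul]
  push_cast
  have hx : a * (((k : ℝ) + 2 - 2) / (k + 1)) + (1 - a) * 1 = 1 - a * (1 / ((k : ℝ) + 1)) := by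
    field_simp
    ring
  have hy : a * (1 / (2 * ((k : ℝ) + 1))) + (1 - a) * (1 / (2 * ((k : ℝ) + 2))) =
      (2 - (1 - a * (1 / ((k : ℝ) + 1)))) / (2 * ((k : ℝ) + 2)) := by
    field_simp
    ring
  have hr : (0 : ℝ) < 1 / ((k : ℝ) + 1) := by positivity
  have har : a * (1 / ((k : ℝ) + 1)) ≤ 1 / ((k : ℝ) + 1) := by nlinarith
  have har' : 0 ≤ a * (1 / ((k : ℝ) + 1)) := by positivity
  have h1 : 1 / (2 * ((k : ℝ) + 1)) ≤ 1 / ((k : ℝ) + 1) := by gcongr; linarith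
  have h2 : 1 / (2 * ((k : ℝ) + 2)) ≤ 1 / ((k : ℝ) + 1) := by gcongr; linarith
  refine ⟨k, by rw [hx]; linarith, by rw [hx]; linarith, by positivity, ?_, by rw [hy, hx]⟩
  nlinarith

/-- The thickening of `Γ` is covered by `N` thin strips and a square at the corner. -/
lemma thickening_Γ_subset {ε : ℝ} (hε : 0 < ε) {N : ℕ} (hN : 1 / ε ≤ N) :
    Metric.thickening ε Γ ⊆
      (⋃ k ∈ Finset.range N, {z : ℝ × ℝ | z.1 ∈ Set.Ioo (1 - 1 / ((k : ℝ) + 1) - ε) (1 + ε) ∧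
        |z.2 - (2 - z.1) / (2 * ((k : ℝ) + 2))| < 2 * ε}) ∪
      Set.Ioo (1 - 2 * ε) (1 + ε) ×ˢ Set.Ioo (-ε) (2 * ε) := by
  intro z hz
  obtain ⟨w, hw, hzw⟩ := Metric.mem_thickening_iff.1 hz
  obtain ⟨k, hk₁, hk₂, hk₃, hk₄, hk₅⟩ := exists_line_of_mem_Γ hw
  rw [Prod.dist_eq, max_lt_iff, Real.dist_eq, Real.dist_eq] at hzw
  obtain ⟨h₁, h₂⟩ := hzw
  have h₁' := abs_lt.1 h₁
  have h₂' := abs_lt.1 h₂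
  by_cases hkN : k < N
  · left
    simp only [Set.mem_iUnion, Finset.mem_range, Set.mem_ofPred_eq]
    refine ⟨k, hkN, ⟨by linarith, by linarith⟩, ?_⟩
    have hsplit : z.2 - (2 - z.1) / (2 * ((k : ℝ) + 2)) =
        (z.2 - w.2) + (z.1 - w.1) / (2 * ((k : ℝ) + 2)) := by
      rw [hk₅]
      ring
    have hk : (0 : ℝ) ≤ k := k.cast_nonneg
    have hslope : |(z.1 - w.1) / (2 * ((k : ℝ) + 2))| ≤ |z.1 - w.1| := by
      rw [abs_div]
      exact div_le_self (abs_nonneg _) (le_abs.2 (Or.inl (by linarith)))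
    rw [hsplit]
    linarith [abs_add_le (z.2 - w.2) ((z.1 - w.1) / (2 * ((k : ℝ) + 2)))]
  · right
    have hNk : (N : ℝ) ≤ k := by exact_mod_cast not_lt.1 hkN
    have hkε : 1 / ((k : ℝ) + 1) ≤ ε := by
      rw [one_div_le (by positivity) hε]
      linarith
    exact ⟨⟨by linarith, by linarith⟩, ⟨by linarith, by linarith⟩⟩

/-- The area of the thickening is bounded by the total area of the strips and the square. -/
lemma volume_thickening_Γ_le {ε : ℝ} (hε : 0 < ε) {N : ℕ} (hN : 1 / ε ≤ N) :
    (volume (Metric.thickening ε Γ)).toReal ≤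
      4 * ε * ((harmonic N : ℝ) + N * (2 * ε)) + 9 * ε ^ 2 := by
  have hsum : 4 * ε * ((harmonic N : ℝ) + N * (2 * ε)) =
      ∑ k ∈ Finset.range N, 2 * (2 * ε) * (1 + ε - (1 - 1 / ((k : ℝ) + 1) - ε)) := by
    have hterm : ∀ k : ℕ, 1 + ε - (1 - 1 / ((k : ℝ) + 1) - ε) = ((k : ℝ) + 1)⁻¹ + 2 * ε := by
      intro k
      rw [one_div]
      ring
    simp only [hterm, ← Finset.mul_sum, Finset.sum_add_distrib, Finset.sum_const,
      Finset.card_range, nsmul_eq_mul, harmonic]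
    push_cast
    ring
  have hnonneg : ∀ k ∈ Finset.range N,
      0 ≤ 2 * (2 * ε) * (1 + ε - (1 - 1 / ((k : ℝ) + 1) - ε)) := by
    intro k _
    have hr : 0 ≤ 1 / ((k : ℝ) + 1) := by positivity
    exact mul_nonneg (by positivity) (by linarith)
  rw [hsum]
  refine ENNReal.toReal_le_of_le_ofReal
    (add_nonneg (Finset.sum_nonneg hnonneg) (by positivity)) ?_
  rw [ENNReal.ofReal_add (Finset.sum_nonneg hnonneg) (by positivity),
    ENNReal.ofReal_sum_of_nonneg hnonneg]
  refine (measure_mono (thickening_Γ_subset hε hN)).trans ((measure_union_le _ _).trans ?_)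
  refine add_le_add ((measure_biUnion_finset_le _ _).trans (Finset.sum_le_sum fun k _ => ?_)) ?_
  · rw [ENNReal.ofReal_mul (by positivity)]
    exact volume_graph_strip_le (f := fun x => (2 - x) / (2 * ((k : ℝ) + 2))) (by fun_prop) _ _ _
  · rw [Measure.volume_eq_prod, Measure.prod_prod, Real.volume_Ioo, Real.volume_Ioo,
      ← ENNReal.ofReal_mul (by linarith)]
    exact ENNReal.ofReal_le_ofReal (by nlinarith)

/-- The Lebesgue measure of an `ε`-neighbourhood of the accumulating family of segments is
of order `ε log (1/ε)`. -/
theorem thickening_of_accumulating_segments :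
    ∃ C : ℝ, 0 < C ∧ ∀ ε : ℝ, 0 < ε → ε < 1 / 2 →
      (volume (Metric.thickening ε Γ)).toReal ≤ C * ε * Real.log (1 / ε) := by
  refine ⟨50, by norm_num, fun ε hε hε' => ?_⟩
  have hinv : 2 < 1 / ε := by
    rw [lt_one_div (by norm_num) hε]
    exact hε'
  have hN₁ : 1 / ε ≤ (⌈1 / ε⌉₊ : ℝ) := Nat.le_ceil _
  have hN₂ : (⌈1 / ε⌉₊ : ℝ) < 1 / ε + 1 := Nat.ceil_lt_add_one (by positivity)
  refine (volume_thickening_Γ_le hε hN₁).trans ?_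
  have hNε : (⌈1 / ε⌉₊ : ℝ) * ε ≤ 3 / 2 := by
    have h : (1 / ε + 1) * ε = 1 + ε := by field_simp
    nlinarith
  have hL : Real.log 2 < Real.log (1 / ε) := Real.log_lt_log (by norm_num) hinv
  have hlogN : Real.log (⌈1 / ε⌉₊ : ℝ) ≤ Real.log 2 + Real.log (1 / ε) := by
    rw [← Real.log_mul (by norm_num) (by positivity)]
    exact Real.log_le_log (by linarith) (by linarith)
  have hharm := harmonic_le_one_add_log ⌈1 / ε⌉₊
  have hlog2 := Real.log_two_gt_d9
  calc 4 * ε * ((harmonic ⌈1 / ε⌉₊ : ℝ) + ⌈1 / ε⌉₊ * (2 * ε)) + 9 * ε ^ 2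
      = ε * (4 * ((harmonic ⌈1 / ε⌉₊ : ℝ) + 2 * (⌈1 / ε⌉₊ * ε)) + 9 * ε) := by ring
    _ ≤ ε * (50 * Real.log (1 / ε)) := by
        refine mul_le_mul_of_nonneg_left ?_ hε.le
        linarith
    _ = 50 * ε * Real.log (1 / ε) := by ring
end
end

section
/- Alignment of unstable directions: let A = !![1, 2; 2, 5] : Matrix (Fin 2) (Fin 2) ℝ. For all real numbers u, v with 0 < u and u ≤ v, writing w_m = (A ^ m).mulVec ![u, v], one has (w_m) 0 > 0 for every m, and the slopes (w_m) 1 / (w_m) 0 converge to 1 + Real.sqrt 2 as m → ∞ (Filter.Tendsto (fun m => (w_m) 1 / (w_m) 0) Filter.atTop (nhds (1 + Real.sqrt 2))). -/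
noncomputable section

/-- The action of `!![1, 2; 2, 5]` on slopes contracts the distance to `1 + √2` on positive
vectors. -/
theorem abs_slope_sub_le {x y : ℝ} (hx : 0 < x) (hy : 0 < y) :
    |(2 * x + 5 * y) / (x + 2 * y) - (1 + √2)| ≤ 1 / 2 * |y / x - (1 + √2)| := by
  have hsq : √2 * √2 = 2 := Real.mul_self_sqrt (by norm_num)
  have hlow : 1.4 ≤ √2 := Real.le_sqrt_of_sq_le (by norm_num)
  have hupp : √2 ≤ 1.5 := Real.sqrt_le_iff.2 (by norm_num)
  have hfactor : (2 * x + 5 * y) / (x + 2 * y) - (1 + √2) =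
      (3 - 2 * √2) * (x / (x + 2 * y)) * (y / x - (1 + √2)) := by
    field_simp
    linear_combination (-2 * x) * hsq
  have hratio : x / (x + 2 * y) ≤ 1 := (div_le_one (by positivity)).2 (by linarith)
  have hratio_nonneg : 0 ≤ x / (x + 2 * y) := by positivity
  rw [hfactor, abs_mul, abs_of_nonneg (mul_nonneg (by linarith) hratio_nonneg)]
  gcongr
  nlinarith

/-- Alignment of unstable directions: iterating `DG · DF = !![1, 2; 2, 5]` on a vector with
positive entries of slope at least one keeps the first component positive and makes the
slope converge to `1 + √2`. -/
theorem slopes_tend_to_unstable_direction (u v : ℝ) (hu : 0 < u) (huv : u ≤ v) :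
    let A : Matrix (Fin 2) (Fin 2) ℝ := !![1, 2; 2, 5]
    (∀ m : ℕ, ((A ^ m).mulVec ![u, v]) 0 > 0) ∧
    Filter.Tendsto (fun m : ℕ => ((A ^ m).mulVec ![u, v]) 1 / ((A ^ m).mulVec ![u, v]) 0)
      Filter.atTop (nhds (1 + Real.sqrt 2)) := by
  intro A
  have hstep (m : ℕ) :
      ((A ^ (m + 1)).mulVec ![u, v]) 0 =
        ((A ^ m).mulVec ![u, v]) 0 + 2 * ((A ^ m).mulVec ![u, v]) 1 ∧
      ((A ^ (m + 1)).mulVec ![u, v]) 1 =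
        2 * ((A ^ m).mulVec ![u, v]) 0 + 5 * ((A ^ m).mulVec ![u, v]) 1 := by
    rw [pow_succ', ← Matrix.mulVec_mulVec]
    generalize (A ^ m).mulVec ![u, v] = w
    simp [A, Matrix.mulVec, dotProduct, Fin.sum_univ_two]
  have hpos (m : ℕ) :
      0 < ((A ^ m).mulVec ![u, v]) 0 ∧ 0 < ((A ^ m).mulVec ![u, v]) 1 := by
    induction m with
    | zero => simpa using ⟨hu, hu.trans_le huv⟩
    | succ m ih =>
      obtain ⟨h0, h1⟩ := ih
      rw [(hstep m).1, (hstep m).2]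
      constructor <;> positivity
  refine ⟨fun m => (hpos m).1, ?_⟩
  have hbound (m : ℕ) :
      |((A ^ m).mulVec ![u, v]) 1 / ((A ^ m).mulVec ![u, v]) 0 - (1 + √2)| ≤
        (1 / 2) ^ m * |v / u - (1 + √2)| := by
    induction m with
    | zero => simp
    | succ m ih =>
      rw [(hstep m).1, (hstep m).2, pow_succ', mul_assoc]
      exact (abs_slope_sub_le (hpos m).1 (hpos m).2).trans (by gcongr)
  refine tendsto_iff_norm_sub_tendsto_zero.2 (squeeze_zero (fun _ => norm_nonneg _) hbound ?_)
  simpa using (tendsto_pow_atTop_nhds_zero_of_lt_one (r := (1 / 2 : ℝ)) (by norm_num)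
    (by norm_num)).mul_const |v / u - (1 + √2)|
end
end
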